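/- Let L be a Boolean saturated orthomodular lattice and p ∈ L. Then the contrary propositions ¬◇¬p and ¬◇p of the orthomodular square of opposition cannot both be true: (¬◇¬p) ∧ (¬◇p) = 0, or equivalently ◇p ∨ ◇¬p = 1. -/

import Mathlib

universe u

/-- An orthomodular structure on a bounded lattice: an involutive De Morgan
orthocomplement satisfying the orthomodular law. -/
class OrthoStructure (α : Type u) [Lattice α] [BoundedOrder α] where
  ocompl : α → α
  ocompl_ocompl : ∀ x : α, ocompl (ocompl x) = x
  ocompl_sup : ∀ x y : α, ocompl (x ⊔ y) = ocompl x ⊓ ocompl y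
  inf_ocompl : ∀ x : α, x ⊓ ocompl x = ⊥
  orthomodular : ∀ x y : α, x ⊔ (ocompl x ⊓ (x ⊔ y)) = x ⊔ y

open OrthoStructure

variable {α : Type u} [Lattice α] [BoundedOrder α] [OrthoStructure α]

/-- Both distributive identities for the ordered triple `(x, y, w)`. -/
def DistribTriple (x y w : α) : Prop :=
  (x ⊔ y) ⊓ w = (x ⊓ w) ⊔ (y ⊓ w) ∧ (x ⊓ y) ⊔ w = (x ⊔ w) ⊓ (y ⊔ w)

/-- `z` is central: both distributive identities hold for every permutation of `(a, b, z)`. -/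
def IsCentral (z : α) : Prop :=
  ∀ a b : α, DistribTriple a b z ∧ DistribTriple a z b ∧ DistribTriple b a z ∧
    DistribTriple b z a ∧ DistribTriple z a b ∧ DistribTriple z b a

/-- The center `Z(α)` of an orthomodular lattice. -/
def center (α : Type u) [Lattice α] [BoundedOrder α] [OrthoStructure α] : Set α :=
  {z | IsCentral z}

/-- A Boolean saturated orthomodular lattice: every element has a smallest
central element `dia p` above it. -/
class BooleanSaturated (α : Type u) [Lattice α] [BoundedOrder α] [OrthoStructure α] where
  dia : α → α
  dia_least : ∀ p : α, IsLeast {z : α | IsCentral z ∧ p ≤ z} (dia p)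

open BooleanSaturated


theorem ocompl_le_ocompl {x y : α} (h : x ≤ y) : ocompl y ≤ ocompl x := by
  rw [← sup_eq_right.mpr h, ocompl_sup]
  exact inf_le_left

theorem ocompl_bot : ocompl (⊥ : α) = ⊤ :=
  top_unique <| by
    simpa only [ocompl_ocompl] using ocompl_le_ocompl (bot_le : (⊥ : α) ≤ ocompl ⊤)

theorem sup_ocompl (x : α) : x ⊔ ocompl x = ⊤ := by
  rw [← ocompl_ocompl (x ⊔ ocompl x), ocompl_sup, inf_ocompl, ocompl_bot]

/-- Contraries of the orthomodular square of opposition cannot both be true: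
`(¬◇¬p) ⊓ (¬◇p) = ⊥`, equivalently `◇p ⊔ ◇¬p = ⊤`. -/
theorem square_contraries [BooleanSaturated α] (p : α) :
    ocompl (dia (ocompl p)) ⊓ ocompl (dia p) = ⊥ ∧ dia p ⊔ dia (ocompl p) = ⊤ := by
  have h : dia p ⊔ dia (ocompl p) = ⊤ :=
    top_unique <| (sup_ocompl p).ge.trans <|
      sup_le_sup (dia_least p).1.2 (dia_least (ocompl p)).1.2
  refine ⟨?_, h⟩
  rw [← ocompl_sup, sup_comm, h, ← ocompl_bot, ocompl_ocompl]
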